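/- arXiv:2406.11529 — 4 statements merged into one kernel-verified Lean document; each statement's English description precedes it below -/
import Mathlib

section
/- Let d be an odd integer and f : ℤ/dℤ → ℂ a function with f(0) = 0 and f(k) ≠ 0 for k ≠ 0. Then f is a C-function if and only if there exists a function g : ℤ/dℤ → ℂ with g(0) = 0 such that f(k)·g(k) = 1 for all k ≠ 0 and f̂(k)·(ǧ)^(k) = 1 for all k ≠ 0, where ǧ(x) := g(−x). -/
/-- The finite Fourier transform on `ℤ/dℤ`,
`f̂ k = (1/√d) ∑_{ℓ} e^{2πikℓ/d} f ℓ`. -/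
noncomputable def fourierZMod {d : ℕ} [NeZero d] (f : ZMod d → ℂ) (k : ZMod d) : ℂ :=
  (1 / Real.sqrt d) *
    ∑ ℓ : ZMod d, Complex.exp (2 * Real.pi * Complex.I * ((k * ℓ).val : ℂ) / d) * f ℓ

open ZMod in
lemma fourierZMod_eq_dft {d : ℕ} [NeZero d] (f : ZMod d → ℂ) (k : ZMod d) :
    fourierZMod f k = (1 / Real.sqrt d) * ∑ l : ZMod d, ZMod.stdAddChar (k * l) * f l := by
  unfold fourierZMod
  congr 1
  refine Finset.sum_congr rfl fun l _ => ?_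
  rw [ZMod.stdAddChar_apply, ZMod.toCircle_apply]

/-- The correlation of `f` and `g`. -/
noncomputable def corr {d : ℕ} [NeZero d] (f g : ZMod d → ℂ) (l : ZMod d) : ℂ :=
  ∑ k : ZMod d, f (k - l) * g k

lemma prod_eq_dft_corr {d : ℕ} [NeZero d] (f g : ZMod d → ℂ) (k : ZMod d) :
    fourierZMod f k * fourierZMod (fun x => g (-x)) k = (1 / (d : ℂ)) * ZMod.dft (corr f g) k := by
  have hs : ((Real.sqrt d : ℝ) : ℂ) * (Real.sqrt d : ℝ) = d := by
    rw [← Complex.ofReal_mul, Real.mul_self_sqrt (Nat.cast_nonneg d)]; simp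
  have hg : ∑ l : ZMod d, ZMod.stdAddChar (k * l) * g (-l)
      = ∑ l : ZMod d, ZMod.stdAddChar (-(k * l)) * g l := by
    refine Fintype.sum_equiv (Equiv.neg _) _ _ fun l => ?_
    simp
  rw [fourierZMod_eq_dft, fourierZMod_eq_dft, mul_mul_mul_comm, one_div_mul_one_div, hs, hg]
  congr 1
  rw [ZMod.dft_apply, Finset.sum_mul_sum, Finset.sum_comm]
  simp only [corr, smul_eq_mul, Finset.mul_sum]
  rw [Finset.sum_comm (γ := ZMod d)]
  rw [Finset.sum_comm]
  conv_rhs => rw [Finset.sum_comm]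
  refine Finset.sum_congr rfl fun b _ => ?_
  refine Fintype.sum_equiv (Equiv.subLeft b) _ _ fun a => ?_
  have : -((b - a) * k) = k * a + -(k * b) := by ring
  simp only [Equiv.subLeft_apply, this, AddChar.map_add_eq_mul, sub_sub_cancel]
  ring

lemma sum_char {d : ℕ} [NeZero d] (k : ZMod d) (hk : k ≠ 0) :
    ∑ j : ZMod d, (ZMod.stdAddChar (-(j * k)) : ℂ) = 0 := by
  have h := AddChar.sum_mulShift (R' := ℂ) (-k) (ZMod.isPrimitive_stdAddChar d)
  rw [if_neg (neg_ne_zero.mpr hk)] at h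
  simpa using h

lemma key {d : ℕ} [NeZero d] (c : ZMod d → ℂ) (h0 : c 0 = d - 1) :
    (∀ l, l ≠ 0 → c l = -1) ↔ ∀ k, k ≠ 0 → (1 / (d : ℂ)) * ZMod.dft c k = 1 := by
  have hd : (d : ℂ) ≠ 0 := Nat.cast_ne_zero.mpr (NeZero.ne d)
  -- the difference with the expected value
  set h : ZMod d → ℂ := fun l => c l - ((if l = 0 then (d : ℂ) else 0) - 1) with hh
  have hdft : ∀ k, k ≠ 0 → ZMod.dft h k = ZMod.dft c k - d := by
    intro k hk
    have := sum_char k hk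
    simp [ZMod.dft_apply, hh, mul_sub, Finset.sum_sub_distrib, this]
  constructor
  · intro hc k hk
    have : h = 0 := by
      funext l
      by_cases hl : l = 0
      · subst hl; simp [hh, h0]
      · simp [hh, hl, hc l hl]
    have h2 := hdft k hk
    rw [this, map_zero, Pi.zero_apply] at h2
    rw [sub_eq_zero.mp h2.symm]
    field_simp
  · intro hF
    have hz : ∀ k, k ≠ 0 → ZMod.dft h k = 0 := by
      intro k hk
      have := hF k hk
      rw [hdft k hk]
      field_simp at this
      rw [this, sub_self]
    have hinv : ∀ l, h l = (d : ℂ)⁻¹ * ZMod.dft h 0 := by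
      intro l
      have e : h l = ZMod.dft.symm (ZMod.dft h) l := by simp
      rw [e, ZMod.invDFT_apply, Finset.sum_eq_single 0]
      · simp
      · intro k _ hk; rw [hz k hk, smul_zero]
      · simp
    intro l hl
    have e : h l = h 0 := by rw [hinv l, hinv 0]
    simp [hh, hl, h0] at e
    linear_combination e

/-- **Lemma 2.4.a.** Let `d` be an odd integer and `f : ℤ/dℤ → ℂ` with `f 0 = 0` and
`f k ≠ 0` for `k ≠ 0`. Then `f` is a `𝒞`-function if and only if there exists
`g : ℤ/dℤ → ℂ` with `g 0 = 0` such that `f k * g k = 1` for all `k ≠ 0` and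
`f̂ k * (ǧ)^ k = 1` for all `k ≠ 0`, where `ǧ x := g (-x)`. -/
theorem C_function_iff_exists_g (d : ℕ) (hodd : Odd d) :
    haveI : NeZero d := ⟨by rintro rfl; simp [Nat.odd_iff] at hodd⟩
    ∀ f : ZMod d → ℂ, f 0 = 0 → (∀ k : ZMod d, k ≠ 0 → f k ≠ 0) →
      ((∀ ℓ : ZMod d, ℓ ≠ 0 →
          ∑ k ∈ Finset.univ.erase (0 : ZMod d), f (k - ℓ) * (f k)⁻¹ = -1) ↔
        ∃ g : ZMod d → ℂ, g 0 = 0 ∧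
          (∀ k : ZMod d, k ≠ 0 → f k * g k = 1) ∧
          (∀ k : ZMod d, k ≠ 0 →
            fourierZMod f k * fourierZMod (fun x => g (-x)) k = 1)) := by
  haveI : NeZero d := ⟨by rintro rfl; simp [Nat.odd_iff] at hodd⟩
  intro f hf0 hf
  have hcorr : ∀ g : ZMod d → ℂ, g 0 = 0 → (∀ k, k ≠ 0 → f k * g k = 1) →
      corr f g 0 = d - 1 ∧ ∀ l, corr f g l =
        ∑ k ∈ Finset.univ.erase (0 : ZMod d), f (k - l) * (f k)⁻¹ := by
    intro g hg0 hg
    have h2 : ∀ l, corr f g l =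
        ∑ k ∈ Finset.univ.erase (0 : ZMod d), f (k - l) * (f k)⁻¹ := by
      intro l
      rw [corr, ← Finset.add_sum_erase _ _ (Finset.mem_univ (0 : ZMod d)), hg0, mul_zero, zero_add]
      refine Finset.sum_congr rfl fun k hk => ?_
      rw [eq_inv_of_mul_eq_one_right (hg k (Finset.ne_of_mem_erase hk))]
    refine ⟨?_, h2⟩
    rw [h2, Finset.sum_congr rfl (g := fun _ => (1 : ℂ))]
    · have : 1 ≤ d := Nat.one_le_iff_ne_zero.mpr (NeZero.ne d)
      simp [Finset.card_erase_of_mem, ZMod.card, Nat.cast_sub this]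
    · intro k hk
      rw [sub_zero, mul_inv_cancel₀ (hf k (Finset.ne_of_mem_erase hk))]
  constructor
  · intro h
    have hg : ∀ k, k ≠ 0 → f k * (f k)⁻¹ = 1 := fun k hk => mul_inv_cancel₀ (hf k hk)
    have hg0 : (f 0)⁻¹ = 0 := by rw [hf0, inv_zero]
    obtain ⟨c0, c1⟩ := hcorr (fun k => (f k)⁻¹) hg0 hg
    refine ⟨fun k => (f k)⁻¹, hg0, hg, fun k hk => ?_⟩
    rw [prod_eq_dft_corr f (fun k => (f k)⁻¹)]
    exact (key _ c0).1 (fun l hl => (c1 l).trans (h l hl)) k hk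
  · rintro ⟨g, hg0, hg, hF⟩ l hl
    obtain ⟨c0, c1⟩ := hcorr g hg0 hg
    rw [← c1]
    exact (key _ c0).2 (fun k hk => by rw [← prod_eq_dft_corr, hF k hk]) l hl
end

section
/- Let p be a prime with p ≡ 3 (mod 4). Let χ be a multiplicative character of 𝔽_p with χ(−1) = −1 whose order is not 2 (i.e. χ is odd and χ is not the Legendre character), and let ψ be a non-trivial multiplicative character of 𝔽_p with ψ(−1) = 1. Then the ratio J(χ̄,ψ)/J(χ,ψ) is not a root of unity; in particular J(χ,ψ) ≠ ψ(−1)·J(χ̄,ψ). -/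
theorem aux_unit (n u v : ℕ) (hn : 0 < n) (h : Nat.gcd u n = Nat.gcd v n) :
    ∃ t : ℕ, t.Coprime n ∧ (t * u) % n = v % n := by
  have : NeZero n := ⟨hn.ne'⟩
  set g := Nat.gcd u n with hg
  have hgpos : 0 < g := Nat.gcd_pos_of_pos_right _ hn
  have hgn : g ∣ n := Nat.gcd_dvd_right _ _
  have hgu : g ∣ u := Nat.gcd_dvd_left _ _
  have hgv : g ∣ v := h ▸ Nat.gcd_dvd_left _ _
  have hu' : Nat.Coprime (u / g) (n / g) := Nat.coprime_div_gcd_div_gcd hgpos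
  have hv' : Nat.Coprime (v / g) (n / g) := by
    rw [h]; exact Nat.coprime_div_gcd_div_gcd (h ▸ hgpos)
  set n' := n / g with hn'
  have hdn : n' ∣ n := Nat.div_dvd_of_dvd hgn
  obtain ⟨w, hw⟩ := ZMod.unitsMap_surjective hdn
    (ZMod.unitOfCoprime _ hv' * (ZMod.unitOfCoprime _ hu')⁻¹)
  refine ⟨(w : ZMod n).val, ZMod.val_coe_unit_coprime w, ?_⟩
  have h1 : ZMod.unitsMap hdn w * ZMod.unitOfCoprime _ hu' = ZMod.unitOfCoprime _ hv' := by
    rw [hw]; simp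
  have h2 := congrArg (fun z : (ZMod n')ˣ => (z : ZMod n')) h1
  simp only [Units.val_mul, ZMod.coe_unitOfCoprime, ZMod.unitsMap_val] at h2
  have h3 : (((w : ZMod n).val * (u / g) : ℕ) : ZMod n') = ((v / g : ℕ) : ZMod n') := by
    rw [← h2]; push_cast
    rw [ZMod.natCast_val]
  rw [ZMod.natCast_eq_natCast_iff] at h3
  have h4 := Nat.ModEq.mul_left' g h3
  have e1 : g * n' = n := Nat.mul_div_cancel' hgn
  have e2 : g * (u / g) = u := Nat.mul_div_cancel' hgu
  have e3 : g * (v / g) = v := Nat.mul_div_cancel' hgv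
  rw [e1, e3, mul_left_comm, e2] at h4
  exact h4

theorem aux_comb (m a b : ℕ) (hm : m % 2 = 1) (ha : a % 2 = 1) (ham : a ≠ m) (ha2 : a < 2 * m)
    (hb : b % 2 = 0) (hb0 : 0 < b) (hb2 : b < 2 * m) :
    ∃ t : ℕ, t.Coprime (2 * m) ∧
      ¬ (2 * m ≤ (t * a) % (2 * m) + (t * b) % (2 * m) ↔
        (t * a) % (2 * m) ≤ (t * b) % (2 * m)) := by
  have hn : 0 < 2 * m := by omega
  set h := Nat.gcd a (2 * m) with hh
  set k := Nat.gcd b (2 * m) with hk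
  have hhn : h ∣ 2 * m := Nat.gcd_dvd_right _ _
  have hha : h ∣ a := Nat.gcd_dvd_left _ _
  have hkn : k ∣ 2 * m := Nat.gcd_dvd_right _ _
  have hkb : k ∣ b := Nat.gcd_dvd_left _ _
  have hkpos : 0 < k := Nat.gcd_pos_of_pos_right _ hn
  have hhpos : 0 < h := Nat.gcd_pos_of_pos_right _ hn
  have hk2 : 2 ∣ k := Nat.dvd_gcd (Nat.dvd_of_mod_eq_zero hb) ⟨m, rfl⟩
  have hhodd : h % 2 = 1 := by
    rcases Nat.mod_two_eq_zero_or_one h with h0 | h0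
    · have := (Nat.dvd_of_mod_eq_zero h0).trans hha
      omega
    · exact h0
  have hhle : h ≤ a := Nat.le_of_dvd (by omega) hha
  have hkle : k ≤ b := Nat.le_of_dvd (by omega) hkb
  -- facts about residues
  have hBdvd : ∀ t, k ∣ (t * b) % (2 * m) := fun t =>
    (Nat.dvd_mod_iff hkn).2 (hkb.mul_left t)
  have hAdvd : ∀ t, h ∣ (t * a) % (2 * m) := fun t =>
    (Nat.dvd_mod_iff hhn).2 (hha.mul_left t)
  have hBlt : ∀ t, (t * b) % (2 * m) < 2 * m := fun t => Nat.mod_lt _ hn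
  have hBpos : ∀ t, t.Coprime (2 * m) → 0 < (t * b) % (2 * m) := by
    intro t ht
    by_contra h0
    have : 2 * m ∣ t * b := Nat.dvd_of_mod_eq_zero (by omega)
    have := Nat.le_of_dvd hb0 (ht.symm.dvd_of_dvd_mul_left this)
    omega
  rcases lt_or_ge h k with hlt | hge
  · obtain ⟨t, ht, hta⟩ := aux_unit (2 * m) a h hn (by
      rw [← hh]; exact (Nat.gcd_eq_left hhn).symm)
    refine ⟨t, ht, ?_⟩
    rw [Nat.mod_eq_of_lt (a := h) (by omega)] at hta
    rw [hta]
    have h1 := Nat.le_of_dvd (hBpos t ht) (hBdvd t)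
    have h2 := Nat.le_of_dvd (by have := hBlt t; omega) (Nat.dvd_sub hkn (hBdvd t))
    have := hBlt t
    omega
  · obtain ⟨k', hk'⟩ := hk2
    have hk'm : k' ∣ m := by
      have := hkn; rw [hk'] at this
      exact Nat.dvd_of_mul_dvd_mul_left (by norm_num) this
    obtain ⟨e, he⟩ := hk'm
    have heodd : e % 2 = 1 := by
      rcases Nat.mod_two_eq_zero_or_one e with h0 | h0
      · have : 2 ∣ m := he ▸ (Nat.dvd_of_mod_eq_zero h0).mul_left k'
        omega
      · exact h0
    obtain ⟨f, hf⟩ : ∃ f, e = 2 * f + 1 := ⟨e / 2, by omega⟩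
    have hgcd : Nat.gcd (m - k') (2 * m) = k := by
      have e1 : m - k' = k * f := by
        rw [he, hf, hk', Nat.mul_add, Nat.mul_one, Nat.add_sub_cancel]; ring
      have e2 : 2 * m = k * e := by rw [he, hk']; ring
      rw [e1, e2, Nat.gcd_mul_left]
      have : Nat.gcd f e = 1 := by
        rw [hf]; simp
      rw [this, mul_one]
    obtain ⟨t, ht, htb⟩ := aux_unit (2 * m) b (m - k') hn (by rw [← hk, hgcd])
    refine ⟨t, ht, ?_⟩
    rw [Nat.mod_eq_of_lt (a := m - k') (by omega)] at htb
    rw [htb]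
    have hk'le : k' ≤ m := Nat.le_of_dvd (by omega) ⟨e, he⟩
    have hhm : h ∣ m := by
      have : Nat.Coprime h 2 := by
        exact (Nat.coprime_two_right).2 (Nat.odd_iff.2 hhodd)
      exact this.dvd_of_dvd_mul_left hhn
    have hne : (t * a) % (2 * m) ≠ m := by
      intro hc
      have : m ∣ t * a := by
        have h1 : m ∣ (t * a) % (2 * m) := by rw [hc]
        exact (Nat.dvd_mod_iff ⟨2, by ring⟩).1 h1
      have h2 : m ∣ a := (Nat.Coprime.coprime_dvd_right ⟨2, by ring⟩ ht).symm.dvd_of_dvd_mul_left this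
      obtain ⟨c, hc⟩ := h2
      have : c < 2 := by
        by_contra h3
        have : m * 2 ≤ m * c := Nat.mul_le_mul_left _ (by omega)
        omega
      interval_cases c <;> omega
    have hAlt := Nat.mod_lt (t * a) hn
    rcases lt_or_gt_of_ne hne with hl | hl
    · have h2 := Nat.le_of_dvd (by omega) (Nat.dvd_sub hhm (hAdvd t))
      omega
    · have h2 := Nat.le_of_dvd (by omega) (Nat.dvd_sub (hAdvd t) hhm)
      omega

theorem aux_powsum (p : ℕ) [Fact p.Prime] (k : ℕ) (h0 : 0 < k) (h2 : k < 2 * (p - 1)) :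
    ∑ x : ZMod p, x ^ k = if k = p - 1 then -1 else 0 := by
  have hp : p.Prime := Fact.out
  have hp2 := hp.two_le
  rcases lt_trichotomy k (p - 1) with h | h | h
  · rw [if_neg h.ne]
    exact FiniteField.sum_pow_lt_card_sub_one (K := ZMod p) k (by rwa [ZMod.card])
  · rw [if_pos h]
    have : ∀ x : ZMod p, x ^ k = 1 - if x = 0 then 1 else 0 := by
      intro x
      by_cases hx : x = 0
      · simp [hx, h0.ne']
      · simp [hx, h, ZMod.pow_card_sub_one_eq_one hx]
    simp [this]
  · rw [if_neg h.ne']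
    have : ∀ x : ZMod p, x ^ k = x ^ (k - (p - 1)) := by
      intro x
      by_cases hx : x = 0
      · simp [hx, h0.ne', Nat.sub_ne_zero_of_lt h]
      · conv_lhs => rw [show k = (k - (p - 1)) + (p - 1) by omega, pow_add,
          ZMod.pow_card_sub_one_eq_one hx, mul_one]
    simp only [this]
    exact FiniteField.sum_pow_lt_card_sub_one (K := ZMod p) _ (by rw [ZMod.card]; omega)

theorem aux_sum (p : ℕ) [Fact p.Prime] (A B : ℕ) (hA : 0 < A) (hA2 : A < p - 1)
    (hB2 : B < p - 1) :
    ∑ x : ZMod p, x ^ A * (1 - x) ^ B ≠ 0 ↔ p - 1 ≤ A + B := by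
  have hp : p.Prime := Fact.out
  have e : ∑ x : ZMod p, x ^ A * (1 - x) ^ B =
      ∑ j ∈ Finset.range (B + 1), (-1) ^ j * (B.choose j : ZMod p) *
        (if A + j = p - 1 then -1 else 0) := by
    have : ∀ x : ZMod p, x ^ A * (1 - x) ^ B =
        ∑ j ∈ Finset.range (B + 1), (-1) ^ j * (B.choose j : ZMod p) * x ^ (A + j) := by
      intro x
      rw [show (1 - x) = -x + 1 by ring, add_pow, Finset.mul_sum]
      refine Finset.sum_congr rfl fun j _ => ?_
      rw [neg_pow, pow_add]; ring
    simp only [this]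
    rw [Finset.sum_comm]
    refine Finset.sum_congr rfl fun j hj => ?_
    rw [Finset.mem_range] at hj
    rw [← Finset.mul_sum, aux_powsum p (A + j) (by omega) (by omega)]
  rw [e]
  constructor
  · intro h
    by_contra hlt
    apply h
    refine Finset.sum_eq_zero fun j hj => ?_
    rw [Finset.mem_range] at hj
    rw [if_neg (by omega), mul_zero]
  · intro h
    rw [Finset.sum_eq_single (p - 1 - A)]
    · rw [if_pos (by omega)]
      have hc : ((B.choose (p - 1 - A) : ℕ) : ZMod p) ≠ 0 := by
        rw [Ne, ZMod.natCast_eq_zero_iff]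
        intro hd
        have h1 : p ∣ B.factorial := by
          rw [← Nat.choose_mul_factorial_mul_factorial (show p - 1 - A ≤ B by omega)]
          exact (hd.mul_right _).mul_right _
        have := (hp.dvd_factorial).1 h1
        omega
      simp [hc]
    · intro j _ hj
      rw [if_neg (by omega), mul_zero]
    · intro hn
      exact absurd (Finset.mem_range.2 (by omega)) hn

open Polynomial in
theorem aux_transfer (p : ℕ) [Fact p.Prime] (hp2 : 2 < p) (ζ : ℂ) (hζ : IsPrimitiveRoot ζ (p - 1))
    (g : (ZMod p)ˣ) (hg : ∀ x, x ∈ Subgroup.zpowers g) (χ χ' ψ : MulChar (ZMod p) ℂ)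
    (a a' b N t : ℕ) (ha : χ g = ζ ^ a) (ha' : χ' g = ζ ^ a') (hb : ψ g = ζ ^ b)
    (ht : t.Coprime (p - 1)) (hA : 0 < (t * a) % (p - 1)) (hA' : 0 < (t * a') % (p - 1))
    (hB : 0 < (t * b) % (p - 1))
    (h : jacobiSum χ' ψ ^ N = jacobiSum χ ψ ^ N) :
    (∑ x : ZMod p, x ^ ((t * a') % (p - 1)) * (1 - x) ^ ((t * b) % (p - 1))) ^ N =
    (∑ x : ZMod p, x ^ ((t * a) % (p - 1)) * (1 - x) ^ ((t * b) % (p - 1))) ^ N := by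
  classical
  have hind : ∀ x : ZMod p, ∃ i : ℕ, x ≠ 0 → x = (g : ZMod p) ^ i := by
    intro x
    by_cases hx : x = 0
    · exact ⟨0, fun h => absurd hx h⟩
    · obtain ⟨i, hi⟩ := (mem_powers_iff_mem_zpowers).2 (hg (Units.mk0 x hx))
      refine ⟨i, fun _ => ?_⟩
      have := congrArg (fun z : (ZMod p)ˣ => (z : ZMod p)) hi
      simpa using this.symm
  choose ind hind using hind
  let P : ℕ → ℤ[X] := fun a => ∑ x : ZMod p, if x = 0 ∨ 1 - x = 0 then 0 else
    (X : ℤ[X]) ^ (a * ind x + b * ind (1 - x))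
  have hchar : ∀ (η : MulChar (ZMod p) ℂ) (c : ℕ), η g = ζ ^ c → ∀ x : ZMod p, x ≠ 0 →
      η x = ζ ^ (c * ind x) := by
    intro η c hc x hx
    conv_lhs => rw [hind x hx, map_pow, hc, ← pow_mul]
  have hJ : ∀ (η : MulChar (ZMod p) ℂ) (c : ℕ), η g = ζ ^ c →
      aeval ζ (P c) = jacobiSum η ψ := by
    intro η c hc
    simp only [P, map_sum, jacobiSum]
    refine Finset.sum_congr rfl fun x _ => ?_
    by_cases hx : x = 0
    · simp [hx, η.map_zero]
    by_cases hx1 : 1 - x = 0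
    · simp [hx1, ψ.map_zero]
    · rw [if_neg (by tauto), hchar η c hc x hx, hchar ψ b hb _ hx1, ← pow_add]
      simp
  have hS : ∀ c : ℕ, 0 < (t * c) % (p - 1) → aeval ((g : ZMod p) ^ t) (P c) =
      ∑ x : ZMod p, x ^ ((t * c) % (p - 1)) * (1 - x) ^ ((t * b) % (p - 1)) := by
    intro c hc
    have hred : ∀ (x : ZMod p) (d : ℕ), x ≠ 0 →
        x ^ ((t * d) % (p - 1)) = ((g : ZMod p) ^ t) ^ (d * ind x) := by
      intro x d hx
      have h1 : x ^ (t * d) = x ^ ((t * d) % (p - 1)) := by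
        conv_lhs => rw [← Nat.div_add_mod (t * d) (p - 1), pow_add, pow_mul,
          ZMod.pow_card_sub_one_eq_one hx, one_pow, one_mul]
      rw [← h1]
      conv_lhs => rw [hind x hx]
      rw [← pow_mul, ← pow_mul]
      congr 1; ring
    simp only [P, map_sum]
    refine Finset.sum_congr rfl fun x _ => ?_
    by_cases hx : x = 0
    · simp [hx, hc.ne']
    by_cases hx1 : 1 - x = 0
    · simp [hx1, hB.ne']
    · rw [if_neg (by tauto), hred x c hx, hred _ b hx1, ← pow_add]
      simp
  have hord : orderOf g = p - 1 := by
    rw [orderOf_eq_card_of_forall_mem_zpowers hg, Nat.card_eq_fintype_card, ZMod.card_units]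
  have hgp : IsPrimitiveRoot ((g : ZMod p) ^ t) (p - 1) := by
    have h1 : IsPrimitiveRoot g (p - 1) := hord ▸ IsPrimitiveRoot.orderOf g
    exact (IsPrimitiveRoot.coe_units_iff.2 h1).pow_of_coprime t ht
  have hz : aeval ζ (P a' ^ N - P a ^ N) = 0 := by
    rw [map_sub, map_pow, map_pow, hJ χ' a' ha', hJ χ a ha, h, sub_self]
  have hpos : 0 < p - 1 := by omega
  have hdvd : cyclotomic (p - 1) ℤ ∣ P a' ^ N - P a ^ N := by
    rw [cyclotomic_eq_minpoly hζ hpos]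
    exact minpoly.isIntegrallyClosed_dvd (hζ.isIntegral hpos) hz
  have hroot : aeval ((g : ZMod p) ^ t) (cyclotomic (p - 1) ℤ) = 0 := by
    have := hgp.isRoot_cyclotomic hpos
    rw [← map_cyclotomic_int, IsRoot.def, eval_map] at this
    rw [aeval_def]; exact this
  obtain ⟨Q, hQ⟩ := hdvd
  have := congrArg (aeval ((g : ZMod p) ^ t)) hQ
  rw [map_mul, hroot, zero_mul, map_sub, map_pow, map_pow, hS a' hA', hS a hA, sub_eq_zero] at this
  exact this

theorem aux_main (p : ℕ) [Fact p.Prime] (hp4 : p % 4 = 3)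
    (χ ψ : MulChar (ZMod p) ℂ)
    (hχodd : χ (-1) = -1) (hχord : orderOf χ ≠ 2)
    (hψ : ψ ≠ 1) (hψeven : ψ (-1) = 1) (N : ℕ) (hN : 0 < N) :
    jacobiSum (χ.ringHomComp (starRingEnd ℂ)) ψ ^ N ≠ jacobiSum χ ψ ^ N := by
  intro h
  obtain ⟨g, hg⟩ := IsCyclic.exists_generator (α := (ZMod p)ˣ)
  have hord : orderOf g = p - 1 := by
    rw [orderOf_eq_card_of_forall_mem_zpowers hg, Nat.card_eq_fintype_card, ZMod.card_units]
  obtain ⟨m, hm⟩ : ∃ m, p - 1 = 2 * m := ⟨(p - 1) / 2, by omega⟩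
  have hmodd : m % 2 = 1 := by omega
  have hpos : p - 1 ≠ 0 := by omega
  have : NeZero (p - 1) := ⟨hpos⟩
  have hζ := Complex.isPrimitiveRoot_exp (p - 1) hpos
  set ζ := Complex.exp (2 * Real.pi * Complex.I / ((p - 1 : ℕ) : ℂ)) with hζdef
  have hgpow : (g : ZMod p) ^ (p - 1) = 1 := by
    rw [← Units.val_pow_eq_pow_val, ← hord, pow_orderOf_eq_one, Units.val_one]
  have hex : ∀ η : MulChar (ZMod p) ℂ, ∃ c < p - 1, η g = ζ ^ c := by
    intro η
    have h1 : η g ^ (p - 1) = 1 := by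
      rw [← map_pow, hgpow, map_one]
    obtain ⟨c, hc, h2⟩ := hζ.eq_pow_of_pow_eq_one h1
    exact ⟨c, hc, h2.symm⟩
  have hgm : (g : ZMod p) ^ m = -1 := by
    have h1 : ((g : ZMod p) ^ m) ^ 2 = 1 := by rw [← pow_mul, mul_comm, ← hm, hgpow]
    rcases (show _ ∨ _ from (sq_eq_sq_iff_eq_or_eq_neg.1 (h1.trans (one_pow 2).symm))) with h2 | h2
    · exfalso
      have h3 : g ^ m = 1 := Units.ext (by simpa using h2)
      have := Nat.le_of_dvd (by omega) (orderOf_dvd_of_pow_eq_one h3)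
      omega
    · exact h2
  have hζm : ζ ^ m = -1 := by
    have h1 : (ζ ^ m) ^ 2 = 1 := by rw [← pow_mul, mul_comm, ← hm, hζ.pow_eq_one]
    rcases (show _ ∨ _ from (sq_eq_sq_iff_eq_or_eq_neg.1 (h1.trans (one_pow 2).symm))) with h2 | h2
    · exfalso
      have := Nat.le_of_dvd (by omega) (hζ.dvd_of_pow_eq_one m h2)
      omega
    · exact h2
  have hneg : ∀ (η : MulChar (ZMod p) ℂ) (c : ℕ), η g = ζ ^ c → η (-1) = (-1) ^ c := by
    intro η c hc
    rw [← hgm, map_pow, hc, ← pow_mul, mul_comm, pow_mul, hζm]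
  obtain ⟨a, ha, hχa⟩ := hex χ
  obtain ⟨b, hb, hψb⟩ := hex ψ
  have haodd : a % 2 = 1 := by
    rcases Nat.even_or_odd a with h1 | h1
    · have := hneg χ a hχa
      rw [hχodd, h1.neg_one_pow] at this
      norm_num at this
    · exact Nat.odd_iff.1 h1
  have hbeven : b % 2 = 0 := by
    rcases Nat.even_or_odd b with h1 | h1
    · exact Nat.even_iff.1 h1
    · have := hneg ψ b hψb
      rw [hψeven, h1.neg_one_pow] at this
      norm_num at this
  have hb0 : 0 < b := by
    rcases Nat.eq_zero_or_pos b with h0 | h0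
    · exfalso
      apply hψ
      rw [MulChar.eq_iff hg, hψb, h0]
      simp
    · exact h0
  have ham : a ≠ m := by
    intro h0
    apply hχord
    apply orderOf_eq_prime
    · rw [MulChar.eq_iff hg, MulChar.pow_apply_coe, hχa, h0, hζm]
      simp
    · intro h1
      rw [h1, MulChar.one_apply (isUnit_one.neg)] at hχodd
      norm_num at hχodd
  have hχa' : (χ.ringHomComp (starRingEnd ℂ)) g = ζ ^ (p - 1 - a) := by
    rw [MulChar.ringHomComp_apply, hχa]
    have hz : ζ ^ a * ζ ^ (p - 1 - a) = 1 := by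
      rw [← pow_add, Nat.add_sub_cancel' ha.le, hζ.pow_eq_one]
    have hn : ‖ζ ^ a‖ = 1 := by
      rw [norm_pow, hζ.norm'_eq_one hpos, one_pow]
    have hc : ζ ^ a * (starRingEnd ℂ) (ζ ^ a) = 1 := by
      rw [Complex.mul_conj, Complex.normSq_eq_norm_sq, hn]; simp
    have hz0 : ζ ^ a ≠ 0 := left_ne_zero_of_mul_eq_one hz
    exact mul_left_cancel₀ hz0 (hc.trans hz.symm)
  obtain ⟨t, ht, hcon⟩ := aux_comb m a b hmodd haodd ham (hm ▸ ha) hbeven hb0 (hm ▸ hb)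
  rw [← hm] at ht hcon
  have hnz : ∀ c, 0 < c → c < p - 1 → 0 < (t * c) % (p - 1) := by
    intro c hc hc'
    by_contra h0
    have h1 : (p - 1) ∣ t * c := Nat.dvd_of_mod_eq_zero (by omega)
    have := Nat.le_of_dvd hc (ht.symm.dvd_of_dvd_mul_left h1)
    omega
  have hA := hnz a (by omega) ha
  have hA' := hnz (p - 1 - a) (by omega) (by omega)
  have hB := hnz b hb0 hb
  have hAlt := Nat.mod_lt (t * a) (Nat.pos_of_ne_zero hpos)
  have hA'lt := Nat.mod_lt (t * (p - 1 - a)) (Nat.pos_of_ne_zero hpos)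
  have hBlt := Nat.mod_lt (t * b) (Nat.pos_of_ne_zero hpos)
  have hsum : (t * a) % (p - 1) + (t * (p - 1 - a)) % (p - 1) = p - 1 := by
    have h1 : (p - 1) ∣ (t * a) % (p - 1) + (t * (p - 1 - a)) % (p - 1) := by
      apply Nat.dvd_of_mod_eq_zero
      rw [← Nat.add_mod, ← Nat.mul_add, Nat.add_sub_cancel' ha.le, Nat.mul_mod_left]
    obtain ⟨c, hc⟩ := h1
    have hc2 : c < 2 := by
      by_contra h3
      have : (p - 1) * 2 ≤ (p - 1) * c := Nat.mul_le_mul_left _ (by omega)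
      omega
    interval_cases c <;> omega
  have key := aux_transfer p (by omega) ζ hζ g hg χ _ ψ a (p - 1 - a) b N t hχa hχa' hψb ht
    hA hA' hB h
  have k1 := aux_sum p _ _ hA hAlt hBlt
  have k2 := aux_sum p _ _ hA' hA'lt hBlt
  have k3 : (∑ x : ZMod p, x ^ ((t * (p - 1 - a)) % (p - 1)) * (1 - x) ^ ((t * b) % (p - 1))) ≠ 0 ↔
      (∑ x : ZMod p, x ^ ((t * a) % (p - 1)) * (1 - x) ^ ((t * b) % (p - 1))) ≠ 0 := by
    rw [← pow_ne_zero_iff hN.ne', key, pow_ne_zero_iff hN.ne']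
  rw [k1, k2] at k3
  apply hcon
  omega


/-- (Consequence of Proposition 3.1, used for Proposition 5.1.) Let `p ≡ 3 (mod 4)`
be prime, `χ` an odd multiplicative character of `𝔽_p` of order different from 2,
and `ψ` a non-trivial even multiplicative character of `𝔽_p`. Then the ratio
`J(χ̄,ψ) / J(χ,ψ)` is not a root of unity; in particular
`J(χ,ψ) ≠ ψ(-1) · J(χ̄,ψ)`. -/
theorem jacobiSum_ratio_not_rootOfUnity
    (p : ℕ) (hp : p.Prime) (hp4 : p % 4 = 3)
    (χ ψ : MulChar (ZMod p) ℂ)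
    (hχodd : χ (-1) = -1) (hχord : orderOf χ ≠ 2)
    (hψ : ψ ≠ 1) (hψeven : ψ (-1) = 1) :
    haveI : NeZero p := ⟨hp.ne_zero⟩
    (¬ ∃ n : ℕ, 0 < n ∧
        (jacobiSum (χ.ringHomComp (starRingEnd ℂ)) ψ / jacobiSum χ ψ) ^ n = 1) ∧
      jacobiSum χ ψ ≠ ψ (-1) * jacobiSum (χ.ringHomComp (starRingEnd ℂ)) ψ := by
  haveI : Fact p.Prime := ⟨hp⟩
  have key := aux_main p hp4 χ ψ hχodd hχord hψ hψeven
  refine ⟨?_, ?_⟩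
  · rintro ⟨n, hn, h⟩
    rw [div_pow] at h
    exact key n hn (eq_of_div_eq_one h)
  · intro h
    rw [hψeven, one_mul] at h
    apply key 1 one_pos
    rw [pow_one, pow_one]
    exact h.symm
end

section
/- Let p ≥ 7 be a prime such that (p−1)/2 is also prime (a safe prime), and let χ₀ be the Legendre character of 𝔽_p. Let α : 𝔽_p → ℂ be an odd function (α(−k) = −α(k) for all k) satisfying: (i) ∑_{ℓ ∈ 𝔽_p} α(k−ℓ)·α(ℓ) = ∑_{ℓ ∈ 𝔽_p} χ₀(k−ℓ)·χ₀(ℓ)·α(ℓ)² for all k ∈ 𝔽_p, and (ii) ∑_{ℓ ∈ C} α(ℓ) = 0, where C = (𝔽_p*)² is the set of non-zero squares of 𝔽_p. Then α = 0. -/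
lemma aux_safe {p : ℕ} [hp : Fact p.Prime] (hp7 : 7 ≤ p) (hsafe : ((p - 1) / 2).Prime) :
    ∃ q, q.Prime ∧ p = 2 * q + 1 ∧ 3 ≤ q := by
  refine ⟨_, hsafe, ?_, by omega⟩
  have := hp.out.eq_two_or_odd
  omega

lemma aux_ne (p n : ℕ) (h0 : 0 < n) (hn : n < p) : ((n : ℕ) : ZMod p) ≠ 0 := by
  rw [Ne, ZMod.natCast_eq_zero_iff]
  exact fun h => absurd (Nat.le_of_dvd h0 h) (by omega)

lemma aux_top (p q : ℕ) [hp : Fact p.Prime] (hq : q.Prime) (hpq : p = 2 * q + 1) (h3 : 3 ≤ q)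
    (H : Subgroup (ZMod p)ˣ) (t : (ZMod p)ˣ) (ht : (t : ZMod p) = 2) (htH : t ∈ H)
    (hneg : -1 ∈ H) : H = ⊤ := by
  have hcard : Nat.card (ZMod p)ˣ = 2 * q := by
    rw [Nat.card_eq_fintype_card, ZMod.card_units_eq_totient, Nat.totient_prime hp.out]
    omega
  have h2' : (2 : ZMod p) ≠ 0 := by exact_mod_cast aux_ne p 2 (by omega) (by omega)
  have h3' : (3 : ZMod p) ≠ 0 := by exact_mod_cast aux_ne p 3 (by omega) (by omega)
  have o1 : orderOf (t ^ 2) = q := by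
    have := Fact.mk hq
    apply orderOf_eq_prime
    · rw [← pow_mul, ← hcard, pow_card_eq_one']
    · intro h
      have : (t : ZMod p) ^ 2 = 1 := by
        rw [← Units.val_pow_eq_pow_val, h, Units.val_one]
      rw [ht] at this
      apply h3'
      linear_combination this
  have o2 : orderOf (-1 : (ZMod p)ˣ) = 2 := by
    apply orderOf_eq_prime
    · simp
    · intro h
      have : (-1 : ZMod p) = 1 := by simpa using congrArg Units.val h
      apply h2'
      linear_combination -this
  have d1 : q ∣ Nat.card H := o1 ▸ H.orderOf_dvd_natCard (H.pow_mem htH 2)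
  have d2 : 2 ∣ Nat.card H := o2 ▸ H.orderOf_dvd_natCard hneg
  have d3 : 2 * q ∣ Nat.card H := by
    apply Nat.Coprime.mul_dvd_of_dvd_of_dvd _ d2 d1
    rw [Nat.coprime_primes Nat.prime_two hq]
    omega
  apply Subgroup.eq_top_of_le_card
  rw [hcard]
  exact Nat.le_of_dvd Nat.card_pos d3

lemma aux_card (p q : ℕ) [hp : Fact p.Prime] (hpq : p = 2 * q + 1) (h3 : 3 ≤ q) :
    (Finset.univ.filter (fun ℓ : ZMod p => ℓ ≠ 0 ∧ ∃ y : ZMod p, ℓ = y ^ 2)).card = q := by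
  have h2 : ringChar (ZMod p) ≠ 2 := by rw [ZMod.ringChar_zmod_n]; omega
  have h := quadraticChar_sum_zero h2
  have e : ∀ x : ZMod p, quadraticChar (ZMod p) x + 1 =
      2 * (if (x ≠ 0 ∧ ∃ y : ZMod p, x = y ^ 2) then 1 else 0) + (if x = 0 then 1 else 0) := by
    intro x
    by_cases hx : x = 0
    · simp [hx]
    · by_cases hs : ∃ y : ZMod p, x = y ^ 2
      · have : quadraticChar (ZMod p) x = 1 := by
          rw [quadraticChar_one_iff_isSquare hx, isSquare_iff_exists_sq]; exact hs
        rw [this, if_pos ⟨hx, hs⟩, if_neg hx]; norm_num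
      · have : quadraticChar (ZMod p) x = -1 := by
          rw [quadraticChar_neg_one_iff_not_isSquare, isSquare_iff_exists_sq]; exact hs
        rw [this, if_neg (fun h => hs h.2), if_neg hx]; norm_num
  have h' := Finset.sum_congr (rfl : (Finset.univ : Finset (ZMod p)) = _) (fun x _ => e x)
  rw [Finset.sum_add_distrib, h, Finset.sum_add_distrib, ← Finset.mul_sum,
    Finset.sum_boole] at h'
  simp [ZMod.card] at h'
  simp only [ne_eq]
  omega

lemma aux_char_two (p q : ℕ) [hp : Fact p.Prime] (hq : q.Prime) (hpq : p = 2 * q + 1)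
    (h3 : 3 ≤ q) {K : Type*} [Field K] (h2 : (2 : K) = 0) (a : ZMod p → K)
    (h0 : a 0 = 0) (hodd : ∀ k : ZMod p, a (-k) = - a k)
    (hi : ∀ k : ZMod p,
      ∑ ℓ : ZMod p, a (k - ℓ) * a ℓ =
        ∑ ℓ : ZMod p, ((quadraticChar (ZMod p) (k - ℓ) : ℤ) : K) *
          ((quadraticChar (ZMod p) ℓ : ℤ) : K) * (a ℓ) ^ 2)
    (hii : ∑ ℓ ∈ Finset.univ.filter
        (fun ℓ : ZMod p => ℓ ≠ 0 ∧ ∃ y : ZMod p, ℓ = y ^ 2), a ℓ = 0) :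
    a = 0 := by
  have h2' : (2 : ZMod p) ≠ 0 := by exact_mod_cast aux_ne p 2 (by omega) (by omega)
  have hneg1 : (-1 : K) = 1 := by linear_combination -h2
  have heven : ∀ k, a (-k) = a k := fun k => by rw [hodd]; linear_combination -(a k) * h2
  have hchi : ∀ x : ZMod p, x ≠ 0 → ((quadraticChar (ZMod p) x : ℤ) : K) = 1 := by
    intro x hx
    rcases quadraticChar_dichotomy hx with h | h <;> simp [h, hneg1]
  have hL : ∀ k : ZMod p, ∑ ℓ : ZMod p, a (k - ℓ) * a ℓ = a (k / 2) ^ 2 := by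
    intro k
    rw [← Finset.add_sum_erase _ _ (Finset.mem_univ (k / 2))]
    have hk : k - k / 2 = k / 2 := by field_simp; ring
    have : ∑ ℓ ∈ Finset.univ.erase (k / 2), a (k - ℓ) * a ℓ = 0 := by
      apply Finset.sum_involution (fun l _ => k - l)
      · intro l _
        rw [sub_sub_cancel]
        linear_combination (a (k - l) * a l) * h2
      · intro l hl _ h
        apply (Finset.mem_erase.mp hl).1
        rw [eq_div_iff h2']
        linear_combination -h
      · intro l hl
        refine Finset.mem_erase.mpr ⟨fun h => (Finset.mem_erase.mp hl).1 ?_, Finset.mem_univ _⟩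
        linear_combination hk - h
      · intro l _
        simp
    rw [this, hk]; ring
  have hS : ∑ l : ZMod p, a l ^ 2 = 0 := by
    apply Finset.sum_involution (fun l _ => -l)
    · intro l _
      rw [heven]; linear_combination (a l ^ 2) * h2
    · intro l _ hl h
      have : l = 0 := by
        have : 2 * l = 0 := by linear_combination -h
        exact (mul_eq_zero.mp this).resolve_left h2'
      simp [this, h0] at hl
    · simp
    · simp
  have hR : ∀ k : ZMod p, ∑ ℓ : ZMod p, ((quadraticChar (ZMod p) (k - ℓ) : ℤ) : K) *
          ((quadraticChar (ZMod p) ℓ : ℤ) : K) * (a ℓ) ^ 2 = - a k ^ 2 := by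
    intro k
    rw [← Finset.add_sum_erase _ _ (Finset.mem_univ k)] at hS ⊢
    rw [eq_neg_of_add_eq_zero_right hS |>.symm]
    rw [sub_self, quadraticChar_zero]
    simp only [Int.cast_zero, zero_mul, zero_add]
    apply Finset.sum_congr rfl
    intro l hl
    by_cases hl0 : l = 0
    · simp [hl0, h0]
    · rw [hchi l hl0, hchi (k - l) (sub_ne_zero.mpr (Finset.mem_erase.mp hl).1.symm)]
      ring
  have hinv : ∀ k, a (2 * k) = a k := by
    intro k
    have h := hi (2 * k)
    rw [hL, hR, mul_div_cancel_left₀ k h2'] at h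
    have : (a (2 * k) - a k) ^ 2 = 0 := by
      linear_combination h - (a (2 * k) * a k) * h2
    exact sub_eq_zero.mp (pow_eq_zero_iff (two_ne_zero) |>.mp this)
  let H : Subgroup (ZMod p)ˣ :=
    { carrier := {u | ∀ x, a (u * x) = a x}
      one_mem' := by simp
      mul_mem' := by
        intro u v hu hv x
        rw [Units.val_mul, mul_assoc, hu, hv]
      inv_mem' := by
        intro u hu x
        have h := hu (((u⁻¹ : (ZMod p)ˣ) : ZMod p) * x)
        rw [Units.mul_inv_cancel_left] at h
        exact h.symm }
  have hH : H = ⊤ := by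
    refine aux_top p q hq hpq h3 H (Units.mk0 2 h2') rfl ?_ ?_
    · intro x; exact hinv x
    · intro x; simpa using heven x
  have hconst : ∀ x, x ≠ 0 → a x = a 1 := by
    intro x hx
    have : Units.mk0 x hx ∈ H := by rw [hH]; trivial
    simpa using this 1
  have h1 : a 1 = 0 := by
    rw [Finset.sum_congr rfl (fun x hx => hconst x (Finset.mem_filter.mp hx).2.1),
      Finset.sum_const, aux_card p q hpq h3] at hii
    obtain ⟨m, hm⟩ : Odd q := hq.odd_of_ne_two (by omega)
    rw [hm, nsmul_eq_mul] at hii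
    push_cast at hii
    linear_combination hii - m * a 1 * h2
  funext x
  by_cases hx : x = 0
  · simp [hx, h0]
  · simp [hconst x hx, h1]

lemma aux_val : ∃ B : ValuationSubring ℂ, (2 : ℂ) ∈ B.nonunits := by
  let A : Subring ℂ := (Int.castRingHom ℂ).range
  let t : A := ⟨2, 2, by simp⟩
  obtain ⟨B, -, hB⟩ := Ideal.image_subset_nonunits_valuationSubring (A := A) (Ideal.span {t})
    (by
      rw [Ne, Ideal.span_singleton_eq_top, isUnit_iff_exists_inv]
      rintro ⟨⟨_, n, rfl⟩, h⟩
      have h' : (2 : ℂ) * (n : ℂ) = 1 := congrArg Subtype.val h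
      have : (2 * n : ℤ) = 1 := by exact_mod_cast h'
      omega)
  exact ⟨B, hB ⟨t, Ideal.subset_span rfl, rfl⟩⟩


/-- **Lemma 5.3.** Let `p ≥ 7` be a safe prime (i.e. `(p-1)/2` is prime) and `χ₀` the
Legendre character of `𝔽_p`. Let `α : 𝔽_p → ℂ` be an odd function satisfying
(i) `α ∗ α = (χ₀ α²) ∗ χ₀` pointwise, i.e.
`∑_ℓ α (k-ℓ) α ℓ = ∑_ℓ χ₀ (k-ℓ) χ₀ ℓ (α ℓ)²` for all `k`, and
(ii) `∑_{ℓ ∈ C} α ℓ = 0` where `C = (𝔽_p^*)²` is the set of non-zero squares.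
Then `α = 0`. -/
theorem odd_solution_of_quadratic_equation_vanishes
    (p : ℕ) [hp : Fact p.Prime] (hp7 : 7 ≤ p) (hsafe : ((p - 1) / 2).Prime)
    (α : ZMod p → ℂ)
    (hodd : ∀ k : ZMod p, α (-k) = - α k)
    (hi : ∀ k : ZMod p,
      ∑ ℓ : ZMod p, α (k - ℓ) * α ℓ =
        ∑ ℓ : ZMod p, ((quadraticChar (ZMod p) (k - ℓ) : ℤ) : ℂ) *
          ((quadraticChar (ZMod p) ℓ : ℤ) : ℂ) * (α ℓ) ^ 2)
    (hii : ∑ ℓ ∈ Finset.univ.filter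
        (fun ℓ : ZMod p => ℓ ≠ 0 ∧ ∃ y : ZMod p, ℓ = y ^ 2), α ℓ = 0) :
    α = 0 := by

  obtain ⟨q, hq, hpq, h3⟩ := aux_safe hp7 hsafe
  by_contra hne
  obtain ⟨B, hB⟩ := aux_val
  have h0 : α 0 = 0 := by
    have := hodd 0
    rw [neg_zero] at this
    linear_combination this / 2
  obtain ⟨m, -, hm⟩ := Finset.exists_max_image Finset.univ (fun x => B.valuation (α x))
    ⟨(0 : ZMod p), Finset.mem_univ _⟩
  have hm0 : α m ≠ 0 := by
    intro h
    apply hne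
    funext x
    have := hm x (Finset.mem_univ _)
    simpa [h] using this
  have hmem : ∀ x, α x / α m ∈ B := by
    intro x
    rw [← B.valuation_le_one_iff, map_div₀]
    exact div_le_one_of_le₀ (hm x (Finset.mem_univ _)) zero_le
  let b : ZMod p → B := fun x => ⟨α x / α m, hmem x⟩
  have hbv : ∀ x, (b x : ℂ) = α x / α m := fun x => rfl
  let r := IsLocalRing.residue B
  have h2 : r 2 = 0 := by
    rw [IsLocalRing.residue_eq_zero_iff, B.valuation_lt_one_iff]
    exact B.mem_nonunits_iff.mp hB
  have key := aux_char_two p q hq hpq h3 (K := IsLocalRing.ResidueField B)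
    (by rw [← h2, map_ofNat]) (fun x => r (b x))
    (by
      have : b 0 = 0 := Subtype.ext (by simp [hbv, h0])
      simp [this])
    (by
      intro k
      have : b (-k) = - b k := Subtype.ext (by simp [hbv, hodd, neg_div])
      simp [this])
    (by
      intro k
      have : ∑ ℓ : ZMod p, b (k - ℓ) * b ℓ =
        ∑ ℓ : ZMod p, ((quadraticChar (ZMod p) (k - ℓ) : ℤ) : B) *
          ((quadraticChar (ZMod p) ℓ : ℤ) : B) * (b ℓ) ^ 2 := by
        apply Subtype.ext
        have e := congrArg (fun z => z / (α m) ^ 2) (hi k)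
        simp only [Finset.sum_div] at e
        push_cast
        simp only [hbv]
        convert e using 2 <;> field_simp
      simpa using congrArg r this)
    (by
      have : ∑ ℓ ∈ Finset.univ.filter
        (fun ℓ : ZMod p => ℓ ≠ 0 ∧ ∃ y : ZMod p, ℓ = y ^ 2), b ℓ = 0 := by
        apply Subtype.ext
        have e := congrArg (fun z => z / α m) hii
        simp only [Finset.sum_div, zero_div] at e
        push_cast
        simpa only [hbv] using e
      simpa only [map_sum, map_zero] using congrArg r this)
  have h1 : b m = 1 := Subtype.ext (by simp [hbv, hm0])
  have := congrFun key m
  simp [h1] at this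
end

section
/- Let p be a prime number. Then the set of C-functions f on 𝔽_p with f(1) = 1 is finite, i.e. the set {f : ℤ/pℤ → ℂ | f(0) = 0, f(1) = 1, f(k) ≠ 0 for all k ≠ 0, and ∑_{k ≠ 0} f(k−ℓ)·f(k)⁻¹ = −1 for all ℓ ≠ 0} is a finite set. -/
open Polynomial in
theorem aux_mult {κ : Type*} [Field κ] (p : ℕ) [CharP κ p] (n : ℕ) :
    ∀ P : κ[X], P ≠ 0 → (∀ k ∈ P.support, k < p) → (X - C 1) ^ n ∣ P → n < P.support.card := by
  induction n with
  | zero =>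
    intro P hP _ _
    exact Finset.card_pos.mpr (Polynomial.support_nonempty.mpr hP)
  | succ n ih =>
    intro P hP hdeg hdvd
    obtain ⟨k0, hk0⟩ := Polynomial.support_nonempty.mpr hP
    set Q : κ[X] := X * derivative P - C (k0 : κ) * P with hQ
    have hcoeff : ∀ k, Q.coeff k = ((k : κ) - k0) * P.coeff k := by
      intro k
      rw [hQ, coeff_sub, coeff_C_mul]
      cases k with
      | zero => simp
      | succ k => rw [coeff_X_mul, coeff_derivative]; push_cast; ring
    have hsub : Q.support ⊆ P.support.erase k0 := by
      intro k hk
      rw [mem_support_iff, hcoeff] at hk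
      rw [Finset.mem_erase, mem_support_iff]
      refine ⟨?_, right_ne_zero_of_mul hk⟩
      rintro rfl
      simp at hk
    have hcard := Finset.card_le_card hsub
    rw [Finset.card_erase_of_mem hk0] at hcard
    have hpos : 0 < P.support.card := Finset.card_pos.mpr ⟨k0, hk0⟩
    have hQd : (X - C 1) ^ n ∣ Q := by
      obtain ⟨R, hR⟩ := hdvd
      refine dvd_sub (Dvd.dvd.mul_left ?_ _) (Dvd.dvd.mul_left ?_ _)
      · rw [hR, derivative_mul, derivative_X_sub_C_pow]
        simp only [Nat.add_sub_cancel]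
        refine dvd_add (Dvd.dvd.mul_right (Dvd.dvd.mul_left dvd_rfl _) _)
          (Dvd.dvd.mul_right (pow_dvd_pow _ (Nat.le_succ n)) _)
      · rw [hR]
        exact Dvd.dvd.mul_right (pow_dvd_pow _ (Nat.le_succ n)) _
    by_cases hQ0 : Q = 0
    · exfalso
      have hP1 : P = monomial k0 (P.coeff k0) := by
        ext k
        rw [coeff_monomial]
        split_ifs with h
        · rw [h]
        · by_contra hne
          have h1 := hcoeff k
          rw [hQ0, coeff_zero] at h1
          rcases mul_eq_zero.mp h1.symm with h2 | h2
          · rw [sub_eq_zero, CharP.natCast_eq_natCast κ p] at h2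
            have := Nat.ModEq.eq_of_lt_of_lt h2 (hdeg k (mem_support_iff.mpr hne)) (hdeg k0 hk0)
            exact h this.symm
          · exact hne h2
      have hroot : P.eval 1 = 0 := by
        have : (X - C 1) ∣ P := dvd_trans (dvd_pow_self _ (Nat.succ_ne_zero n)) hdvd
        exact dvd_iff_isRoot.mp this
      rw [hP1, eval_monomial] at hroot
      simp at hroot
      exact (mem_support_iff.mp hk0) hroot
    · have := ih Q hQ0 (fun k hk => hdeg k (Finset.mem_of_mem_erase (hsub hk))) hQd
      omega

open Polynomial in
noncomputable def auxT {κ : Type*} [Field κ] {p : ℕ} [NeZero p] (u : ZMod p → κ) : κ[X] :=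
  ∑ j : ZMod p, monomial j.val (u j)

open Polynomial in
theorem auxT_coeff {κ : Type*} [Field κ] {p : ℕ} [NeZero p] (u : ZMod p → κ) (j : ZMod p) :
    (auxT u).coeff j.val = u j := by
  unfold auxT
  rw [finsetSum_coeff, Finset.sum_eq_single j]
  · simp
  · intro b _ hb
    rw [coeff_monomial, if_neg]
    exact fun h => hb (ZMod.val_injective p h)
  · simp

open Polynomial Classical in
theorem auxT_support {κ : Type*} [Field κ] {p : ℕ} [NeZero p] (u : ZMod p → κ) :
    (auxT u).support ⊆ (Finset.univ.filter (fun j => u j ≠ 0)).image ZMod.val := by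
  intro k hk
  rw [mem_support_iff] at hk
  unfold auxT at hk
  rw [finsetSum_coeff] at hk
  obtain ⟨j, _, hj⟩ := Finset.exists_ne_zero_of_sum_ne_zero hk
  rw [coeff_monomial] at hj
  split_ifs at hj with h
  · exact Finset.mem_image.mpr ⟨j, by simpa using hj, h⟩
  · exact absurd rfl hj

open Polynomial Classical in
theorem auxT_mult {κ : Type*} [Field κ] {p : ℕ} [NeZero p] [CharP κ p] (u : ZMod p → κ)
    (hu : ∃ j, u j ≠ 0) :
    auxT u ≠ 0 ∧
    (auxT u).rootMultiplicity 1 < (Finset.univ.filter (fun j => u j ≠ 0)).card := by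
  have h0 : auxT u ≠ 0 := by
    obtain ⟨j, hj⟩ := hu
    intro h
    apply hj
    rw [← auxT_coeff u j, h, coeff_zero]
  refine ⟨h0, ?_⟩
  refine lt_of_lt_of_le (aux_mult p _ (auxT u) h0 ?_ (pow_rootMultiplicity_dvd _ _)) ?_
  · intro k hk
    obtain ⟨j, _, rfl⟩ := Finset.mem_image.mp (auxT_support u hk)
    exact ZMod.val_lt j
  · exact (Finset.card_le_card (auxT_support u)).trans Finset.card_image_le

open Polynomial in
theorem auxT_dvd {κ : Type*} [Field κ] {p : ℕ} [NeZero p] (u w : ZMod p → κ)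
    (h : ∀ l, ∑ k, u (k - l) * w k = 0) :
    (X ^ p - 1 : κ[X]) ∣ auxT u * auxT (fun j => w (-j)) := by
  rw [← Ideal.mem_span_singleton, ← Ideal.Quotient.eq_zero_iff_mem]
  set I := Ideal.span {(X ^ p - 1 : κ[X])} with hI
  set φ := Ideal.Quotient.mk I with hφ
  have hx : (φ X) ^ p = 1 := by
    rw [← map_pow, ← sub_eq_zero, ← map_one φ, ← map_sub, hφ, Ideal.Quotient.eq_zero_iff_mem, hI]
    exact Ideal.mem_span_singleton_self _
  have hadd : ∀ a b : ZMod p, (φ X) ^ a.val * (φ X) ^ b.val = (φ X) ^ (a + b).val := by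
    intro a b
    rw [← pow_add, ZMod.val_add, pow_eq_pow_mod _ hx]
  have h1 : ∀ v : ZMod p → κ, φ (auxT v) = ∑ j, φ (C (v j)) * (φ X) ^ j.val := by
    intro v
    unfold auxT
    rw [map_sum]
    refine Finset.sum_congr rfl fun j _ => ?_
    rw [← C_mul_X_pow_eq_monomial, map_mul, map_pow]
  have h2 : φ (auxT (fun j => w (-j))) = ∑ k, φ (C (w k)) * (φ X) ^ (-k).val := by
    rw [h1]
    refine Fintype.sum_equiv (Equiv.neg _) _ _ fun j => ?_
    simp
  rw [map_mul, h1, h2, Finset.sum_mul_sum, Finset.sum_comm]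
  have h3 : ∀ k : ZMod p, ∑ j, φ (C (u j)) * (φ X) ^ j.val * (φ (C (w k)) * (φ X) ^ (-k).val)
      = ∑ l, φ (C (u (k - l) * w k)) * (φ X) ^ (-l).val := by
    intro k
    refine Fintype.sum_equiv (Equiv.subLeft k) _ _ fun j => ?_
    simp only [Equiv.subLeft_apply, sub_sub_cancel, map_mul]
    rw [show -(k - j) = j + -k by ring, ← hadd]
    ring
  rw [Finset.sum_congr rfl fun k _ => h3 k, Finset.sum_comm]
  refine Finset.sum_eq_zero fun l _ => ?_
  rw [← Finset.sum_mul, ← map_sum, ← map_sum, h l]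
  simp

open Polynomial Classical in
theorem aux_charp {κ : Type*} [Field κ] {p : ℕ} [NeZero p] [hp : Fact p.Prime] [CharP κ p]
    (u w : ZMod p → κ)
    (huw : ∀ j, u j * w j = 0)
    (hu : ∃ j, u j ≠ 0) (hw : ∃ j, w j ≠ 0)
    (h : ∀ l, ∑ k, u (k - l) * w k = 0) : False := by
  have hd := auxT_dvd u w h
  obtain ⟨hU, hUm⟩ := auxT_mult u hu
  obtain ⟨hW, hWm⟩ := auxT_mult (fun j => w (-j)) (by
    obtain ⟨j, hj⟩ := hw
    exact ⟨-j, by simpa using hj⟩)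
  have hc : (Finset.univ.filter (fun j => w (-j) ≠ 0)).card
      = (Finset.univ.filter (fun j => w j ≠ 0)).card := by
    refine Finset.card_bij (fun j _ => -j) ?_ ?_ ?_
    · simp
    · simp
    · intro b hb
      exact ⟨-b, by simpa using hb, by simp⟩
  have hdisj : Disjoint (Finset.univ.filter (fun j => u j ≠ 0))
      (Finset.univ.filter (fun j => w j ≠ 0)) := by
    rw [Finset.disjoint_filter]
    intro j _ h1 h2
    exact (mul_ne_zero h1 h2) (huw j)
  have hle : (Finset.univ.filter (fun j => u j ≠ 0)).card
      + (Finset.univ.filter (fun j => w j ≠ 0)).card ≤ p := by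
    rw [← Finset.card_union_of_disjoint hdisj]
    refine (Finset.card_le_univ _).trans ?_
    rw [ZMod.card]
  have hXp : (X ^ p - 1 : κ[X]) = (X - C 1) ^ p := by
    rw [sub_pow_char, C_1, one_pow]
  rw [hXp] at hd
  have h1 := (le_rootMultiplicity_iff (mul_ne_zero hU hW)).mpr hd
  rw [rootMultiplicity_mul (mul_ne_zero hU hW)] at h1
  omega

open Polynomial in
theorem aux_val_s11 {K : Type*} [Field K] (p : ℕ) [Fact p.Prime] (t : K) (ht : Transcendental ℤ t) :
    ∃ B : ValuationSubring K, B.valuation (p : K) < 1 ∧ B.valuation t⁻¹ < 1 := by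
  have ht' : Transcendental ℤ t⁻¹ := fun h => ht (IsAlgebraic.inv_iff.mp h)
  let φ : ℤ[X] →+* K := (aeval (R := ℤ) t⁻¹ : ℤ[X] →ₐ[ℤ] K).toRingHom
  have hφ : Function.Injective φ := transcendental_iff_injective.mp ht'
  let e : ℤ[X] ≃+* φ.range := RingEquiv.ofBijective φ.rangeRestrict
    ⟨fun a b h => hφ (congrArg Subtype.val h), φ.rangeRestrict_surjective⟩
  let ψ : ℤ[X] →+* ZMod p := eval₂RingHom (Int.castRingHom (ZMod p)) 0
  let θ : φ.range →+* ZMod p := ψ.comp e.symm.toRingHom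
  obtain ⟨B, hB1, hB2⟩ := Ideal.image_subset_nonunits_valuationSubring (RingHom.ker θ)
    (RingHom.ker_ne_top θ)
  have key : ∀ q : ℤ[X], ψ q = 0 → B.valuation (φ q) < 1 := by
    intro q hq
    rw [← ValuationSubring.mem_nonunits_iff]
    refine hB2 ⟨e q, ?_, rfl⟩
    change ψ (e.symm (e q)) = 0
    rw [e.symm_apply_apply, hq]
  refine ⟨B, ?_, ?_⟩
  · have := key (p : ℤ[X]) (by simp)
    simpa using this
  · have := key X (by simp [ψ])
    simpa [φ] using this

theorem aux_alg {K : Type*} [Field K] {p : ℕ} [NeZero p] [hp : Fact p.Prime]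
    (f g : ZMod p → K) (hf0 : f 0 = 0) (hg0 : g 0 = 0) (hfg : ∀ k, k ≠ 0 → f k * g k = 1)
    (hf1 : f 1 = 1) (hsum : ∀ l, l ≠ 0 → ∑ k, f (k - l) * g k = -1) (k₀ : ZMod p) :
    IsAlgebraic ℤ (f k₀) := by
  by_contra htr
  obtain ⟨B, hBp, hBt⟩ := aux_val_s11 p (f k₀) htr
  have h10 : (1 : ZMod p) ≠ 0 := one_ne_zero
  have hg1 : g 1 = 1 := by simpa [hf1] using hfg 1 h10
  have hk0 : f k₀ ≠ 0 := by
    intro h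
    exact htr (h ▸ isAlgebraic_zero)
  obtain ⟨a, ha⟩ := Finite.exists_max (fun k => B.valuation (f k))
  obtain ⟨b, hb⟩ := Finite.exists_max (fun k => B.valuation (g k))
  have hfa : 1 < B.valuation (f a) := by
    refine lt_of_lt_of_le ?_ (ha k₀)
    rw [map_inv₀] at hBt
    exact (inv_lt_one₀ (zero_lt_iff.mpr ((Valuation.ne_zero_iff _).mpr hk0))).mp hBt
  have hgb : 1 ≤ B.valuation (g b) := by
    have := hb 1
    simpa [hg1] using this
  have hfa0 : f a ≠ 0 := by
    intro h
    simp [h] at hfa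
  have hgb0 : g b ≠ 0 := by
    intro h
    simp [h] at hgb
  have hinv : B.valuation ((f a * g b)⁻¹) < 1 := by
    rw [map_inv₀, map_mul]
    have h1 : 1 < B.valuation (f a) * B.valuation (g b) :=
      lt_of_lt_of_le hfa (le_mul_of_one_le_right' hgb)
    exact inv_lt_one_of_one_lt₀ h1
  have hfm : ∀ k, f k / f a ∈ B := by
    intro k
    rw [← ValuationSubring.valuation_le_one_iff, map_div₀]
    exact div_le_one_of_le₀ (ha k) zero_le
  have hgm : ∀ k, g k / g b ∈ B := by
    intro k
    rw [← ValuationSubring.valuation_le_one_iff, map_div₀]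
    exact div_le_one_of_le₀ (hb k) zero_le
  let F : ZMod p → B := fun k => ⟨f k / f a, hfm k⟩
  let G : ZMod p → B := fun k => ⟨g k / g b, hgm k⟩
  have hres : ∀ x : B, B.valuation (x : K) < 1 → IsLocalRing.residue B x = 0 := by
    intro x hx
    rw [IsLocalRing.residue_eq_zero_iff]
    exact (ValuationSubring.valuation_lt_one_iff B x).mpr hx
  have : CharP (IsLocalRing.ResidueField B) p := by
    have h0 : ((p : ℕ) : IsLocalRing.ResidueField B) = 0 := by
      have := hres (p : B) (by simpa using hBp)
      simpa using this
    exact ringChar.of_eq (CharP.ringChar_of_prime_eq_zero hp.out h0)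
  have hpt : ∀ j, f j * g j * (f a * g b)⁻¹ = (F j * G j : B) := by
    intro j
    change _ = f j / f a * (g j / g b)
    field_simp
  have hpw : ∀ j, IsLocalRing.residue B (F j) * IsLocalRing.residue B (G j) = 0 := by
    intro j
    rw [← map_mul]
    apply hres
    rw [← hpt]
    by_cases hj : j = 0
    · simp [hj, hf0]
    · rw [hfg j hj, one_mul]
      exact hinv
  refine aux_charp (κ := IsLocalRing.ResidueField B) (fun j => IsLocalRing.residue B (F j))
    (fun j => IsLocalRing.residue B (G j)) hpw ⟨a, ?_⟩ ⟨b, ?_⟩ ?_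
  · have : F a = 1 := Subtype.ext (div_self hfa0)
    simp [this]
  · have : G b = 1 := Subtype.ext (div_self hgb0)
    simp [this]
  · intro l
    by_cases hl : l = 0
    · refine Finset.sum_eq_zero fun k _ => ?_
      rw [hl, sub_zero]
      exact hpw k
    · simp only [← map_mul, ← map_sum]
      apply hres
      have : ((∑ k, F (k - l) * G k : B) : K) = -(f a * g b)⁻¹ := by
        rw [← B.subtype_apply, map_sum]
        rw [neg_eq_neg_one_mul, ← hsum l hl, Finset.sum_mul]
        refine Finset.sum_congr rfl fun k _ => ?_
        change f (k - l) / f a * (g k / g b) = _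
        field_simp
      rw [this, Valuation.map_neg]
      exact hinv

theorem aux_const {K : Type*} [Field K] [Algebra ℂ K] {p : ℕ} [NeZero p] [hp : Fact p.Prime]
    (f g : ZMod p → K) (hf0 : f 0 = 0) (hg0 : g 0 = 0) (hfg : ∀ k, k ≠ 0 → f k * g k = 1)
    (hf1 : f 1 = 1) (hsum : ∀ l, l ≠ 0 → ∑ k, f (k - l) * g k = -1) (k : ZMod p) :
    ∃ c, algebraMap ℂ K c = f k := by
  have halg := aux_alg f g hf0 hg0 hfg hf1 hsum k
  have halgC : IsAlgebraic ℂ (f k) := halg.extendScalars Int.cast_injective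
  have hint : IsIntegral ℂ (f k) := isAlgebraic_iff_isIntegral.mp halgC
  exact minpoly.mem_range_of_degree_eq_one ℂ _
    (IsAlgClosed.degree_eq_one_of_irreducible ℂ (minpoly.irreducible hint))

open MvPolynomial in
theorem aux_finite {p : ℕ} [NeZero p] [hp : Fact p.Prime] :
    Set.Finite {f : ZMod p → ℂ |
      f 0 = 0 ∧ f 1 = 1 ∧ (∀ k : ZMod p, k ≠ 0 → f k ≠ 0) ∧
      ∀ l : ZMod p, l ≠ 0 →
        ∑ k ∈ Finset.univ.erase (0 : ZMod p), f (k - l) * (f k)⁻¹ = -1} := by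
  set S := {f : ZMod p → ℂ |
      f 0 = 0 ∧ f 1 = 1 ∧ (∀ k : ZMod p, k ≠ 0 → f k ≠ 0) ∧
      ∀ l : ZMod p, l ≠ 0 →
        ∑ k ∈ Finset.univ.erase (0 : ZMod p), f (k - l) * (f k)⁻¹ = -1} with hS
  let R := MvPolynomial (ZMod p ⊕ ZMod p) ℂ
  let ev : (ZMod p → ℂ) → (R →ₐ[ℂ] ℂ) := fun f => aeval (Sum.elim f (fun k => (f k)⁻¹))
  have hevX : ∀ f k, ev f (X (Sum.inl k)) = f k := fun f k => aeval_X _ _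
  have hevY : ∀ f k, ev f (X (Sum.inr k)) = (f k)⁻¹ := fun f k => aeval_X _ _
  have hevC : ∀ f c, ev f (C c) = c := fun f c => aeval_C _ _
  let I : Ideal R := ⨅ f : S, RingHom.ker (ev f)
  have hIfin := Ideal.finite_minimalPrimes_of_isNoetherianRing R I
  have hmem : ∀ x : R, (∀ f ∈ S, ev f x = 0) → x ∈ I := by
    intro x hx
    simp only [I, Ideal.mem_iInf]
    intro f
    exact hx f f.2
  have hex : ∀ f : S, ∃ q ∈ I.minimalPrimes, q ≤ RingHom.ker (ev f) := by
    intro f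
    have : (RingHom.ker (ev f)).IsPrime := RingHom.ker_isPrime _
    exact Ideal.exists_minimalPrimes_le (iInf_le _ f)
  choose q hq hqle using hex
  have hconst : ∀ f : S, ∀ k, X (Sum.inl k) - C (f.1 k) ∈ q f := by
    intro f k
    have hqp : (q f).IsPrime := (hq f).1.1
    have hIq : I ≤ q f := (hq f).1.2
    let A := R ⧸ q f
    let K := FractionRing A
    let π : R →ₐ[ℂ] K := (IsScalarTower.toAlgHom ℂ A K).comp (Ideal.Quotient.mkₐ ℂ (q f))
    have hπ : ∀ x, π x = 0 ↔ x ∈ q f := by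
      intro x
      change algebraMap A K (Ideal.Quotient.mk (q f) x) = 0 ↔ _
      rw [FaithfulSMul.algebraMap_eq_zero_iff, Ideal.Quotient.eq_zero_iff_mem]
    have hrel : ∀ x : R, (∀ f ∈ S, ev f x = 0) → π x = 0 := fun x hx =>
      (hπ x).mpr (hIq (hmem x hx))
    obtain ⟨c, hc⟩ : ∃ c, algebraMap ℂ K c = π (X (Sum.inl k)) := by
      refine aux_const (fun k => π (X (Sum.inl k))) (fun k => π (X (Sum.inr k))) ?_ ?_ ?_ ?_ ?_ k
      · apply hrel
        rintro g ⟨h0, h1, h2, h3⟩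
        simp [hevX, hevY, h0]
      · apply hrel
        rintro g ⟨h0, h1, h2, h3⟩
        simp [hevX, hevY, h0]
      · intro j hj
        rw [← sub_eq_zero, ← map_mul, ← map_one π, ← map_sub]
        apply hrel
        rintro g ⟨h0, h1, h2, h3⟩
        simp [hevX, hevY, h2 j hj]
      · rw [← sub_eq_zero, ← map_one π, ← map_sub]
        apply hrel
        rintro g ⟨h0, h1, h2, h3⟩
        simp [hevX, hevY, h1]
      · intro l hl
        rw [← sub_eq_zero, ← map_one π, ← map_neg]
        simp only [← map_mul, ← map_sum, ← map_sub]
        apply hrel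
        rintro g ⟨h0, h1, h2, h3⟩
        have h4 := h3 l hl
        have h5 : ∑ k, g (k - l) * (g k)⁻¹ = -1 := by
          rw [← h4]
          symm
          apply Finset.sum_erase
          simp [h0]
        simp [hevX, hevY, h5]
    have hcm : X (Sum.inl k) - C c ∈ q f := by
      rw [← hπ, map_sub, ← hc, sub_eq_zero]
      exact (π.commutes c).symm
    have hcf : c = f.1 k := by
      have h1 : ev f (X (Sum.inl k) - C c) = 0 := hqle f hcm
      rw [map_sub, hevX, hevC, sub_eq_zero] at h1
      exact h1.symm
    rw [← hcf]
    exact hcm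
  have : Finite I.minimalPrimes := hIfin
  have : Finite S := by
    refine Finite.of_injective (fun f : S => (⟨q f, hq f⟩ : I.minimalPrimes)) ?_
    intro f g hfg
    have hfg' : q f = q g := congrArg Subtype.val hfg
    apply Subtype.ext
    funext k
    have h1 : ev g (X (Sum.inl k) - C (f.1 k)) = 0 := hqle g (hfg' ▸ hconst f k)
    rw [map_sub, hevX, hevC, sub_eq_zero] at h1
    exact h1.symm
  exact Set.toFinite S

/-- **Proposition 6.1 (Biró).** Let `p` be prime. Then the set of `𝒞`-functions `f`
on `𝔽_p` with `f 1 = 1` is finite. -/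
theorem setOf_C_functions_finite (p : ℕ) (hp : p.Prime) :
    haveI : NeZero p := ⟨hp.ne_zero⟩
    Set.Finite {f : ZMod p → ℂ |
      f 0 = 0 ∧ f 1 = 1 ∧ (∀ k : ZMod p, k ≠ 0 → f k ≠ 0) ∧
      ∀ ℓ : ZMod p, ℓ ≠ 0 →
        ∑ k ∈ Finset.univ.erase (0 : ZMod p), f (k - ℓ) * (f k)⁻¹ = -1} := by
  haveI : NeZero p := ⟨hp.ne_zero⟩
  haveI : Fact p.Prime := ⟨hp⟩
  exact aux_finite
end
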